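/- Let κ > 0 and ρ, ϱ, μ, α ∈ ℝ. Define Λ(y₁,y₂,y₃) = ( (2/κ)y₁, (2/κ)y₂, y₃·exp(−(ρ/κ)(y₁²+y₂²)) ) with inverse Λ⁻¹(x₁,x₂,x₃) = ( (κ/2)x₁, (κ/2)x₂, x₃·exp((ρκ/4)(x₁²+x₂²)) ) on ℝ × ℝ × (0,∞), and define the vector field h(y₁,y₂,y₃) = ( −(ϱ/2)y₁, −(ϱ/2)y₂, μ y₃ − (κρ/2) y₃ − y₃ (ρ²/2 + α)(y₁²+y₂²) ). Then for every x ∈ ℝ × ℝ × (0,∞), ∇Λ(Λ⁻¹(x)) · h(Λ⁻¹(x)) = ( −(ϱ/2)x₁, −(ϱ/2)x₂, x₃·[ μ − κρ/2 + ( κρϱ/4 − κ²(ρ²+2α)/8 )·(x₁²+x₂²) ] ), where ∇Λ(y) denotes the Jacobian matrix of Λ at y. -/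

import Mathlib

/-- The action of the derivative of `y ↦ (a y₁, a y₂, y₃ exp (b (y₁² + y₂²)))` on a vector. -/
theorem fderiv_scale_mul_exp_apply (a b : ℝ) (y v : ℝ × ℝ × ℝ) :
    fderiv ℝ (fun y : ℝ × ℝ × ℝ =>
        (a * y.1, a * y.2.1, y.2.2 * Real.exp (b * (y.1 ^ 2 + y.2.1 ^ 2)))) y v
      = (a * v.1, a * v.2.1, (v.2.2 + y.2.2 * (b * (2 * y.1 * v.1 + 2 * y.2.1 * v.2.1)))
          * Real.exp (b * (y.1 ^ 2 + y.2.1 ^ 2))) := by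
  have h₁ : HasFDerivAt (fun y : ℝ × ℝ × ℝ => y.1)
      (ContinuousLinearMap.fst ℝ ℝ (ℝ × ℝ)) y := hasFDerivAt_fst
  have h₂₃ : HasFDerivAt (fun y : ℝ × ℝ × ℝ => y.2)
      (ContinuousLinearMap.snd ℝ ℝ (ℝ × ℝ)) y := hasFDerivAt_snd
  have h₂ := h₂₃.fst
  have h₃ := h₂₃.snd
  have hexp := (((h₁.pow 2).add (h₂.pow 2)).const_mul b).exp
  have hmain := (h₁.const_mul a).prodMk ((h₂.const_mul a).prodMk (h₃.mul hexp))
  refine (congrArg (fun L : ℝ × ℝ × ℝ →L[ℝ] ℝ × ℝ × ℝ => L v) hmain.fderiv).trans ?_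
  ext
  · simp
  · simp
  · simp
    ring

/-- Formula (49): the transformed drift ĥ = ∇Λ·h∘Λ⁻¹ of the extended
Heston-type SDE, where Λ is the linearizing diffeomorphism, Γ = Λ⁻¹, and h is
the Fisk–Stratonovich drift (46). -/
theorem stmt11 (κ ρ ϱ μ α : ℝ) (hκ : 0 < κ)
    (Λ Γ h : ℝ × ℝ × ℝ → ℝ × ℝ × ℝ)
    (hΛ : ∀ y, Λ y = ((2 / κ) * y.1, (2 / κ) * y.2.1,
        y.2.2 * Real.exp (-(ρ / κ) * (y.1 ^ 2 + y.2.1 ^ 2))))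
    (hΓ : ∀ x, Γ x = ((κ / 2) * x.1, (κ / 2) * x.2.1,
        x.2.2 * Real.exp ((ρ * κ / 4) * (x.1 ^ 2 + x.2.1 ^ 2))))
    (hh : ∀ y, h y = (-(ϱ / 2) * y.1, -(ϱ / 2) * y.2.1,
        μ * y.2.2 - (κ * ρ / 2) * y.2.2
          - y.2.2 * (ρ ^ 2 / 2 + α) * (y.1 ^ 2 + y.2.1 ^ 2))) :
    ∀ x : ℝ × ℝ × ℝ, 0 < x.2.2 →
      fderiv ℝ Λ (Γ x) (h (Γ x))
        = (-(ϱ / 2) * x.1, -(ϱ / 2) * x.2.1,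
            x.2.2 * (μ - κ * ρ / 2
              + (κ * ρ * ϱ / 4 - κ ^ 2 * (ρ ^ 2 + 2 * α) / 8)
                  * (x.1 ^ 2 + x.2.1 ^ 2))) := by
  intro x _
  have hκ₀ : κ ≠ 0 := hκ.ne'
  rw [funext hΛ, fderiv_scale_mul_exp_apply, hh, hΓ]
  have hexponent : -(ρ / κ) * ((κ / 2 * x.1) ^ 2 + (κ / 2 * x.2.1) ^ 2)
      = -(ρ * κ / 4 * (x.1 ^ 2 + x.2.1 ^ 2)) := by
    field_simp
    ring
  have hcancel : Real.exp (ρ * κ / 4 * (x.1 ^ 2 + x.2.1 ^ 2))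
      * Real.exp (-(ρ * κ / 4 * (x.1 ^ 2 + x.2.1 ^ 2))) = 1 := by
    rw [← Real.exp_add, add_neg_cancel, Real.exp_zero]
  simp only [hexponent]
  generalize Real.exp (ρ * κ / 4 * (x.1 ^ 2 + x.2.1 ^ 2)) = E at hcancel ⊢
  generalize Real.exp (-(ρ * κ / 4 * (x.1 ^ 2 + x.2.1 ^ 2))) = F at hcancel ⊢
  ext
  · field_simp
  · field_simp
  · trans x.2.2 * (μ - κ * ρ / 2
      + (κ * ρ * ϱ / 4 - κ ^ 2 * (ρ ^ 2 + 2 * α) / 8) * (x.1 ^ 2 + x.2.1 ^ 2)) * (E * F)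
    · field_simp
      ring
    · rw [hcancel, mul_one]
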